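/- arXiv:1807.11664 — 2 statements merged into one kernel-verified Lean document; each statement's English description precedes it below -/
import Mathlib

section
/- Suppose g, g_0 ∈ SO(8,ℂ) satisfy g_0 e_0 = e_0 and (g_0 x)(g y) = g(xy) for all x, y ∈ 𝕆_ℂ. If moreover g e_0 = e_0, then g_0 = g and g ∈ G_2(ℂ). Conversely, every g ∈ G_2(ℂ) satisfies g e_0 = e_0 and (with g_0 = g) the relation (g_0 x)(g y) = g(xy) for all x, y. Hence G_2(ℂ) = {g ∈ B_3(ℂ) : g e_0 = e_0}. -/
open Matrix

noncomputable section

/-- The standard basis of the complexified Cayley algebra `𝕆_ℂ = ℂ^8`. -/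
def e (i : Fin 8) : Fin 8 → ℂ := Pi.single i 1

/-- The oriented lines of the multiplication table of the Cayley algebra:
`(i, j, k)` in this list means `e_i e_j = e_k`. -/
def octLines : List (Fin 8 × Fin 8 × Fin 8) :=
  [(1,2,3),(2,3,1),(3,1,2),
   (1,4,5),(4,5,1),(5,1,4),
   (1,6,7),(6,7,1),(7,1,6),
   (2,5,7),(5,7,2),(7,2,5),
   (2,6,4),(6,4,2),(4,2,6),
   (3,5,6),(5,6,3),(6,3,5),
   (3,4,7),(4,7,3),(7,3,4)]

/-- Product of two basis elements of the complexified Cayley algebra. -/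
def octBasisMul (i j : Fin 8) : Fin 8 → ℂ :=
  if i = 0 then e j
  else if j = 0 then e i
  else if i = j then -(e 0)
  else
    match octLines.find? (fun t => t.1 == i && t.2.1 == j) with
    | some t => e t.2.2
    | none =>
      match octLines.find? (fun t => t.1 == j && t.2.1 == i) with
      | some t => -(e t.2.2)
      | none => 0

/-- The bilinear multiplication of the complexified Cayley algebra `𝕆_ℂ`. -/
def octMul (x y : Fin 8 → ℂ) : Fin 8 → ℂ :=
  ∑ i, ∑ j, (x i * y j) • octBasisMul i j

/-- The standard symmetric bilinear form on `ℂ^8`. -/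
def bform (v w : Fin 8 → ℂ) : ℂ := ∑ i, v i * w i

/-- `SO(8, ℂ)`. -/
def SO8 (g : Matrix (Fin 8) (Fin 8) ℂ) : Prop := gᵀ * g = 1 ∧ g.det = 1

/-- A matrix has real entries. -/
def realMat (g : Matrix (Fin 8) (Fin 8) ℂ) : Prop := ∀ i j, (g i j).im = 0

/-- The realization of `G₂(ℂ)` as automorphisms of `𝕆_ℂ`. -/
def inG2 (g : Matrix (Fin 8) (Fin 8) ℂ) : Prop :=
  SO8 g ∧ ∀ x y, g.mulVec (octMul x y) = octMul (g.mulVec x) (g.mulVec y)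

/-- The compact real form `G₂`. -/
def inG2cpt (g : Matrix (Fin 8) (Fin 8) ℂ) : Prop := inG2 g ∧ realMat g

/-- The realization `B₃(ℂ)` of `Spin(7, ℂ)`. -/
def inB3 (g : Matrix (Fin 8) (Fin 8) ℂ) : Prop :=
  SO8 g ∧ ∃ g₀, SO8 g₀ ∧ g₀.mulVec (e 0) = e 0 ∧
    ∀ x y, octMul (g₀.mulVec x) (g.mulVec y) = g.mulVec (octMul x y)

/-- The compact real form `Spin(7)`. -/
def inSpin7 (g : Matrix (Fin 8) (Fin 8) ℂ) : Prop :=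
  SO8 g ∧ realMat g ∧ ∃ g₀, SO8 g₀ ∧ realMat g₀ ∧ g₀.mulVec (e 0) = e 0 ∧
    ∀ x y, octMul (g₀.mulVec x) (g.mulVec y) = g.mulVec (octMul x y)

/-- The one-parameter group `t_θ` (abelian slice `A₁` for `(G₂(ℂ), SL(3,ℂ))`). -/
def tmat (θ : ℝ) : Matrix (Fin 8) (Fin 8) ℂ :=
  Matrix.of fun i j =>
    (![ e 0,
        (Real.cosh θ : ℂ) • e 1 + (Complex.I * (Real.sinh θ : ℂ)) • e 2,
        (-(Complex.I * (Real.sinh θ : ℂ))) • e 1 + (Real.cosh θ : ℂ) • e 2,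
        e 3,
        (Real.cosh (θ/2) : ℂ) • e 4 + (-(Complex.I * (Real.sinh (θ/2) : ℂ))) • e 7,
        (Real.cosh (θ/2) : ℂ) • e 5 + (-(Complex.I * (Real.sinh (θ/2) : ℂ))) • e 6,
        (Complex.I * (Real.sinh (θ/2) : ℂ)) • e 5 + (Real.cosh (θ/2) : ℂ) • e 6,
        (Complex.I * (Real.sinh (θ/2) : ℂ)) • e 4 + (Real.cosh (θ/2) : ℂ) • e 7 ] j) i

/-- The generator `τ₁` of the one-parameter group `A₁`, i.e. `exp (θ τ₁) = t_θ`. -/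
def tau1 : Matrix (Fin 8) (Fin 8) ℂ :=
  Matrix.of fun i j =>
    (![ 0,
        Complex.I • e 2,
        (-Complex.I) • e 1,
        0,
        (-(Complex.I/2)) • e 7,
        (-(Complex.I/2)) • e 6,
        (Complex.I/2) • e 5,
        (Complex.I/2) • e 4 ] j) i

/-- The one-parameter group `ã_θ` (abelian slice `Ã₀` for `(Spin(7,ℂ), G₂(ℂ))`). -/
def atil (θ : ℝ) : Matrix (Fin 8) (Fin 8) ℂ :=
  Matrix.of fun i j =>
    (![ (Real.cosh θ : ℂ) • e 0 + (Complex.I * (Real.sinh θ : ℂ)) • e 1,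
        (-(Complex.I * (Real.sinh θ : ℂ))) • e 0 + (Real.cosh θ : ℂ) • e 1,
        (Real.cosh (θ/3) : ℂ) • e 2 + (-(Complex.I * (Real.sinh (θ/3) : ℂ))) • e 3,
        (Complex.I * (Real.sinh (θ/3) : ℂ)) • e 2 + (Real.cosh (θ/3) : ℂ) • e 3,
        (Real.cosh (θ/3) : ℂ) • e 4 + (-(Complex.I * (Real.sinh (θ/3) : ℂ))) • e 5,
        (Complex.I * (Real.sinh (θ/3) : ℂ)) • e 4 + (Real.cosh (θ/3) : ℂ) • e 5,
        (Real.cosh (θ/3) : ℂ) • e 6 + (-(Complex.I * (Real.sinh (θ/3) : ℂ))) • e 7,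
        (Complex.I * (Real.sinh (θ/3) : ℂ)) • e 6 + (Real.cosh (θ/3) : ℂ) • e 7 ] j) i

/-- The generator `α̃₁` of the one-parameter group `Ã₀`, i.e. `exp (θ α̃₁) = ã_θ`. -/
def alphatil1 : Matrix (Fin 8) (Fin 8) ℂ :=
  Matrix.of fun i j =>
    (![ Complex.I • e 1,
        (-Complex.I) • e 0,
        (-(Complex.I/3)) • e 3,
        (Complex.I/3) • e 2,
        (-(Complex.I/3)) • e 5,
        (Complex.I/3) • e 4,
        (-(Complex.I/3)) • e 7,
        (Complex.I/3) • e 6 ] j) i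

/-- The one-parameter group `a_x` (abelian slice `A₀` for `(SO(7,ℂ), G₂(ℂ))`). -/
def amat (x : ℝ) : Matrix (Fin 8) (Fin 8) ℂ :=
  Matrix.of fun i j =>
    (![ e 0,
        e 1,
        (Real.cosh x : ℂ) • e 2 + (Complex.I * (Real.sinh x : ℂ)) • e 3,
        (-(Complex.I * (Real.sinh x : ℂ))) • e 2 + (Real.cosh x : ℂ) • e 3,
        (Real.cosh x : ℂ) • e 4 + (Complex.I * (Real.sinh x : ℂ)) • e 5,
        (-(Complex.I * (Real.sinh x : ℂ))) • e 4 + (Real.cosh x : ℂ) • e 5,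
        (Real.cosh x : ℂ) • e 6 + (Complex.I * (Real.sinh x : ℂ)) • e 7,
        (-(Complex.I * (Real.sinh x : ℂ))) • e 6 + (Real.cosh x : ℂ) • e 7 ] j) i

/-- The matrix `I₊₋ = diag(1, −1, 1, −1, 1, −1, 1, −1)`. -/
def Ipm : Matrix (Fin 8) (Fin 8) ℂ :=
  Matrix.diagonal ![1, -1, 1, -1, 1, -1, 1, -1]

/-- The anti-holomorphic involution `σ₀(g) = I₊₋ ḡ I₊₋`. -/
def sigma0 (g : Matrix (Fin 8) (Fin 8) ℂ) : Matrix (Fin 8) (Fin 8) ℂ :=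
  Ipm * g.map (starRingEnd ℂ) * Ipm

end

theorem octMul_e_zero (x : Fin 8 → ℂ) : octMul x (e 0) = x := by
  have h : ∀ i, octBasisMul i 0 = e i := by
    intro i
    by_cases hi : i = 0 <;> simp [octBasisMul, hi]
  have hx : ∀ i, ∑ j, (x i * e 0 j) • octBasisMul i j = x i • e i := by
    intro i
    rw [Finset.sum_eq_single 0 (fun j _ hj => by simp [e, hj]) (by simp), h]
    simp [e]
  simp only [octMul, hx]
  exact (pi_eq_sum_univ' x).symm

theorem e_zero_octMul (x : Fin 8 → ℂ) : octMul (e 0) x = x := by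
  rw [octMul, Finset.sum_eq_single 0 (fun i _ hi => by simp [e, hi]) (by simp)]
  have hx : ∀ j, (e 0 0 * x j) • octBasisMul 0 j = x j • e j := by
    intro j
    simp [octBasisMul, e]
  simp only [hx]
  exact (pi_eq_sum_univ' x).symm

theorem inG2.mulVec_e_zero {g : Matrix (Fin 8) (Fin 8) ℂ} (hg : inG2 g) :
    g.mulVec (e 0) = e 0 := by
  have hu : g.mulVec (gᵀ.mulVec (e 0)) = e 0 := by
    rw [Matrix.mulVec_mulVec, mul_eq_one_comm.mp hg.1.1, Matrix.one_mulVec]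
  have h := hg.2 (e 0) (gᵀ.mulVec (e 0))
  rw [e_zero_octMul, hu, octMul_e_zero] at h
  exact h.symm

theorem eq_of_triality_of_mulVec_e_zero {g g₀ : Matrix (Fin 8) (Fin 8) ℂ}
    (h : ∀ x y, octMul (g₀.mulVec x) (g.mulVec y) = g.mulVec (octMul x y))
    (he : g.mulVec (e 0) = e 0) : g₀ = g := by
  refine Matrix.mulVec_injective (funext fun x => ?_)
  have hx := h x (e 0)
  rwa [he, octMul_e_zero, octMul_e_zero] at hx

/-- If `g, g₀ ∈ SO(8,ℂ)` satisfy `g₀ e₀ = e₀` and `(g₀ x)(g y) = g(xy)` for all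
`x, y ∈ 𝕆_ℂ`, and moreover `g e₀ = e₀`, then `g₀ = g` and `g ∈ G₂(ℂ)`.  Conversely,
every `g ∈ G₂(ℂ)` fixes `e₀` and satisfies the triality relation with `g₀ = g`.
Hence `G₂(ℂ) = {g ∈ B₃(ℂ) : g e₀ = e₀}`. -/
theorem stmt2 :
    (∀ g g₀ : Matrix (Fin 8) (Fin 8) ℂ, SO8 g → SO8 g₀ →
      g₀.mulVec (e 0) = e 0 →
      (∀ x y, octMul (g₀.mulVec x) (g.mulVec y) = g.mulVec (octMul x y)) →
      g.mulVec (e 0) = e 0 → g₀ = g ∧ inG2 g) ∧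
    (∀ g : Matrix (Fin 8) (Fin 8) ℂ, inG2 g → g.mulVec (e 0) = e 0 ∧
      ∀ x y, octMul (g.mulVec x) (g.mulVec y) = g.mulVec (octMul x y)) ∧
    {g : Matrix (Fin 8) (Fin 8) ℂ | inG2 g}
      = {g : Matrix (Fin 8) (Fin 8) ℂ | inB3 g ∧ g.mulVec (e 0) = e 0} := by
  refine ⟨fun g g₀ hg _ _ h he => ?_, fun g hg => ⟨hg.mulVec_e_zero, fun x y => (hg.2 x y).symm⟩,
    Set.ext fun g => ⟨fun hg => ?_, ?_⟩⟩
  · obtain rfl := eq_of_triality_of_mulVec_e_zero h he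
    exact ⟨rfl, hg, fun x y => (h x y).symm⟩
  · have he := inG2.mulVec_e_zero hg
    exact ⟨⟨hg.1, g, hg.1, he, fun x y => (hg.2 x y).symm⟩, he⟩
  · rintro ⟨⟨hg, g₀, -, -, h⟩, he⟩
    obtain rfl := eq_of_triality_of_mulVec_e_zero h he
    exact ⟨hg, fun x y => (h x y).symm⟩
end

section
/- For every θ ∈ ℝ, the matrix t_θ belongs to G_2(ℂ): t_θ ∈ SO(8,ℂ) and (t_θ x)(t_θ y) = t_θ(xy) for all x, y ∈ 𝕆_ℂ. Moreover A_1 = {t_θ : θ ∈ ℝ} is a one-dimensional abelian group: t_θ t_{θ'} = t_{θ+θ'} for all θ, θ' ∈ ℝ. -/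
open Matrix

/-- The Cayley product in coordinates. -/
theorem octMul_eq (x y : Fin 8 → ℂ) : octMul x y =
    ![x 0 * y 0 - x 1 * y 1 - x 2 * y 2 - x 3 * y 3 - x 4 * y 4 - x 5 * y 5 - x 6 * y 6 - x 7 * y 7,
      x 0 * y 1 + x 1 * y 0 + x 2 * y 3 - x 3 * y 2 + x 4 * y 5 - x 5 * y 4 + x 6 * y 7 - x 7 * y 6,
      x 0 * y 2 + x 2 * y 0 + x 3 * y 1 - x 1 * y 3 + x 5 * y 7 - x 7 * y 5 + x 6 * y 4 - x 4 * y 6,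
      x 0 * y 3 + x 3 * y 0 + x 1 * y 2 - x 2 * y 1 + x 5 * y 6 - x 6 * y 5 + x 4 * y 7 - x 7 * y 4,
      x 0 * y 4 + x 4 * y 0 + x 5 * y 1 - x 1 * y 5 + x 2 * y 6 - x 6 * y 2 + x 7 * y 3 - x 3 * y 7,
      x 0 * y 5 + x 5 * y 0 + x 1 * y 4 - x 4 * y 1 + x 7 * y 2 - x 2 * y 7 + x 6 * y 3 - x 3 * y 6,
      x 0 * y 6 + x 6 * y 0 + x 7 * y 1 - x 1 * y 7 + x 4 * y 2 - x 2 * y 4 + x 3 * y 5 - x 5 * y 3,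
      x 0 * y 7 + x 7 * y 0 + x 1 * y 6 - x 6 * y 1 + x 2 * y 5 - x 5 * y 2 + x 3 * y 4 - x 4 * y 3] := by
  funext k
  fin_cases k <;>
  · simp [octMul, octBasisMul, octLines, Fin.sum_univ_eight, List.find?, e]
    ring

/-- The matrix shape of `t_θ`, with free entries. -/
def rotMat (c s a b : ℂ) : Matrix (Fin 8) (Fin 8) ℂ :=
  !![1, 0, 0, 0, 0, 0, 0, 0;
     0, c, -s, 0, 0, 0, 0, 0;
     0, s, c, 0, 0, 0, 0, 0;
     0, 0, 0, 1, 0, 0, 0, 0;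
     0, 0, 0, 0, a, 0, 0, b;
     0, 0, 0, 0, 0, a, b, 0;
     0, 0, 0, 0, 0, -b, a, 0;
     0, 0, 0, 0, -b, 0, 0, a]

theorem tmat_eq_rotMat (θ : ℝ) : tmat θ =
    rotMat (Real.cosh θ) (Complex.I * Real.sinh θ)
      (Real.cosh (θ / 2)) (Complex.I * Real.sinh (θ / 2)) := by
  ext i j
  fin_cases i <;> fin_cases j <;> simp [tmat, rotMat, e]

theorem rotMat_mul (c s a b d t p q : ℂ) :
    rotMat c s a b * rotMat d t p q =
      rotMat (c * d - s * t) (s * d + c * t) (a * p - b * q) (b * p + a * q) := by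
  ext i j
  fin_cases i <;> fin_cases j <;>
    simp [rotMat, Matrix.mul_apply, Fin.sum_univ_eight] <;> ring

theorem rotMat_transpose (c s a b : ℂ) :
    (rotMat c s a b)ᵀ = rotMat c (-s) a (-b) := by
  ext i j
  fin_cases i <;> fin_cases j <;> simp [rotMat]

theorem rotMat_one_zero : rotMat 1 0 1 0 = 1 := by
  ext i j
  fin_cases i <;> fin_cases j <;> simp [rotMat]

theorem tmat_mul (θ θ' : ℝ) : tmat θ * tmat θ' = tmat (θ + θ') := by
  simp only [tmat_eq_rotMat, rotMat_mul, add_div, Real.cosh_add, Real.sinh_add]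
  push_cast
  congr 1 <;> ring_nf <;> simp only [Complex.I_sq] <;> ring

theorem tmat_transpose_mul (θ : ℝ) : (tmat θ)ᵀ * tmat θ = 1 := by
  have htr : (tmat θ)ᵀ = tmat (-θ) := by
    simp [tmat_eq_rotMat, rotMat_transpose, neg_div]
  rw [htr, tmat_mul, neg_add_cancel, tmat_eq_rotMat]
  simp [rotMat_one_zero]

theorem det_tmat (θ : ℝ) : (tmat θ).det = 1 := by
  have h := congrArg Matrix.det (tmat_transpose_mul (θ / 2))
  rwa [det_mul, det_transpose, det_one, ← det_mul, tmat_mul, add_halves] at h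

theorem rotMat_mulVec (c s a b : ℂ) (x : Fin 8 → ℂ) :
    (rotMat c s a b).mulVec x =
      ![x 0, c * x 1 - s * x 2, s * x 1 + c * x 2, x 3,
        a * x 4 + b * x 7, a * x 5 + b * x 6, a * x 6 - b * x 5, a * x 7 - b * x 4] := by
  funext k
  fin_cases k <;> simp [rotMat, Matrix.mulVec, dotProduct, Fin.sum_univ_eight] <;> ring

/-- A rotation with half-angle entries `c, s` is multiplicative for the Cayley product. -/
theorem octMul_rotMat_mulVec {c s : ℂ} (h : c ^ 2 + s ^ 2 = 1) (x y : Fin 8 → ℂ) :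
    octMul ((rotMat (c ^ 2 - s ^ 2) (2 * c * s) c s).mulVec x)
        ((rotMat (c ^ 2 - s ^ 2) (2 * c * s) c s).mulVec y) =
      (rotMat (c ^ 2 - s ^ 2) (2 * c * s) c s).mulVec (octMul x y) := by
  have hs : s ^ 2 = 1 - c ^ 2 := by linear_combination h
  have hs3 : s ^ 3 = s * (1 - c ^ 2) := by rw [← hs]; ring
  have hs4 : s ^ 4 = (1 - c ^ 2) ^ 2 := by rw [← hs]; ring
  simp only [rotMat_mulVec, octMul_eq]
  funext k
  fin_cases k <;>
  · simp
    ring_nf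
    try simp only [hs, hs3, hs4]
    try ring

theorem octMul_tmat_mulVec (θ : ℝ) (x y : Fin 8 → ℂ) :
    octMul ((tmat θ).mulVec x) ((tmat θ).mulVec y) = (tmat θ).mulVec (octMul x y) := by
  have hcosh : (Real.cosh θ : ℂ) =
      (Real.cosh (θ / 2) : ℂ) ^ 2 - (Complex.I * Real.sinh (θ / 2)) ^ 2 := by
    have := Real.cosh_two_mul (θ / 2)
    rw [mul_div_cancel₀ θ two_ne_zero] at this
    rw [this, mul_pow, Complex.I_sq]
    push_cast
    ring
  have hsinh : Complex.I * (Real.sinh θ : ℂ) =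
      2 * (Real.cosh (θ / 2) : ℂ) * (Complex.I * Real.sinh (θ / 2)) := by
    have := Real.sinh_two_mul (θ / 2)
    rw [mul_div_cancel₀ θ two_ne_zero] at this
    rw [this]
    push_cast
    ring
  have hone : (Real.cosh (θ / 2) : ℂ) ^ 2 + (Complex.I * Real.sinh (θ / 2)) ^ 2 = 1 := by
    rw [mul_pow, Complex.I_sq]
    have := Real.cosh_sq_sub_sinh_sq (θ / 2)
    have h := congrArg (fun r : ℝ => (r : ℂ)) this
    push_cast at h ⊢
    linear_combination h
  rw [tmat_eq_rotMat, hcosh, hsinh]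
  exact octMul_rotMat_mulVec hone x y

/-- **Lemma `lem:a1-g2`.** For every `θ ∈ ℝ` the matrix `t_θ` belongs to `G₂(ℂ)`:
it lies in `SO(8,ℂ)` and satisfies `(t_θ x)(t_θ y) = t_θ (xy)` for all `x, y ∈ 𝕆_ℂ`.
Moreover `A₁ = {t_θ : θ ∈ ℝ}` is a one-dimensional abelian group:
`t_θ t_θ' = t_{θ+θ'}`. -/
theorem stmt6 :
    (∀ θ : ℝ, SO8 (tmat θ) ∧
      ∀ x y, octMul ((tmat θ).mulVec x) ((tmat θ).mulVec y)
        = (tmat θ).mulVec (octMul x y)) ∧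
    (∀ θ θ' : ℝ, tmat θ * tmat θ' = tmat (θ + θ')) := by
  exact ⟨fun θ => ⟨⟨tmat_transpose_mul θ, det_tmat θ⟩, octMul_tmat_mulVec θ⟩, tmat_mul⟩
end
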